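/- (Relation between the Luttinger-Ward and self-energy expansion coefficients) Let U(x) = (1/8) Σ_{i,j=1}^n v_{ij} x_i² x_j² be a quartic interaction with symmetric coefficient matrix v such that U has superquadratic growth. Fix a symmetric positive definite n×n matrix G, and let Φ^(k)[G;U] and Σ^(k)[G;U] be the coefficients of the asymptotic series of Φ[G; εU] and Σ[G; εU] at ε = 0. Then for every k ≥ 1, Φ^(k)[G;U] = (1/(2k)) Tr[G Σ^(k)[G;U]]. -/

import Mathlib

open MeasureTheory Matrix Filter Topology Real Asymptotics

attribute [local instance] Matrix.normedAddCommGroup Matrix.normedSpace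

noncomputable section

/-- The partition function `Z[A] = ∫ exp(-½ xᵀAx - U(x)) dx`. -/
def Zfun (n : ℕ) (U : (Fin n → ℝ) → ℝ) (A : Matrix (Fin n) (Fin n) ℝ) : ℝ :=
  ∫ x : Fin n → ℝ, Real.exp (-(1 / 2) * (x ⬝ᵥ A.mulVec x) - U x)

/-- The free energy `Ω[A] = -log Z[A]`. -/
def Omega (n : ℕ) (U : (Fin n → ℝ) → ℝ) (A : Matrix (Fin n) (Fin n) ℝ) : ℝ :=
  - Real.log (Zfun n U A)

/-- `U` is continuous with superquadratic growth: for every `c > 0`,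
`U x - c * |x|² → +∞` as `|x| → ∞`. -/
def SuperQuadratic {n : ℕ} (U : (Fin n → ℝ) → ℝ) : Prop :=
  Continuous U ∧ ∀ c : ℝ, 0 < c →
    Tendsto (fun x : Fin n → ℝ => U x - c * ‖x‖ ^ 2) (cocompact _) atTop

/-- A probability density on `ℝⁿ` with finite second moments and finite
differential entropy. -/
def IsGoodDensity {n : ℕ} (ρ : (Fin n → ℝ) → ℝ) : Prop :=
  Measurable ρ ∧ (∀ x, 0 ≤ ρ x) ∧ (∫ x, ρ x) = 1 ∧
  (∀ i j : Fin n, Integrable fun x => x i * x j * ρ x) ∧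
  Integrable fun x => ρ x * Real.log (ρ x)

/-- Differential entropy `S(ρ) = -∫ ρ log ρ`. -/
def entropy {n : ℕ} (ρ : (Fin n → ℝ) → ℝ) : ℝ := - ∫ x, ρ x * Real.log (ρ x)

/-- Second-moment matrix `𝒢(ρ) = ∫ x xᵀ ρ(x) dx`. -/
def momMatrix {n : ℕ} (ρ : (Fin n → ℝ) → ℝ) : Matrix (Fin n) (Fin n) ℝ :=
  Matrix.of fun i j => ∫ x, x i * x j * ρ x

/-- `𝓕[G;U] = sup { S(ρ) - ∫ U ρ : ρ ∈ 𝓜, 𝒢(ρ) = G }`. -/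
def Ffun (n : ℕ) (U : (Fin n → ℝ) → ℝ) (G : Matrix (Fin n) (Fin n) ℝ) : ℝ :=
  sSup { r : ℝ | ∃ ρ : (Fin n → ℝ) → ℝ, IsGoodDensity ρ ∧
    (Integrable fun x => U x * ρ x) ∧ momMatrix ρ = G ∧
    r = entropy ρ - ∫ x, U x * ρ x }

/-- The Luttinger-Ward functional `Φ[G;U] = 2𝓕[G;U] - Tr[log G] - n log(2πe)`.
(For positive definite `G`, `Tr[log G] = log det G`.) -/
def Phi (n : ℕ) (U : (Fin n → ℝ) → ℝ) (G : Matrix (Fin n) (Fin n) ℝ) : ℝ :=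
  2 * Ffun n U G - Real.log G.det - (n : ℝ) * Real.log (2 * π * Real.exp 1)

/-- The continuous linear functional `H ↦ Tr[S * H]` on matrices. -/
def tracePairing {n : ℕ} (S : Matrix (Fin n) (Fin n) ℝ) :
    Matrix (Fin n) (Fin n) ℝ →L[ℝ] ℝ :=
  LinearMap.toContinuousLinearMap
    { toFun := fun H => (S * H).trace
      map_add' := fun H K => by simp [Matrix.mul_add]
      map_smul' := fun c H => by simp [Matrix.mul_smul] }

def ASet (n : ℕ) (U : (Fin n → ℝ) → ℝ) (G : Matrix (Fin n) (Fin n) ℝ) : Set ℝ :=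
  { r : ℝ | ∃ ρ : (Fin n → ℝ) → ℝ, IsGoodDensity ρ ∧
    (Integrable fun x => U x * ρ x) ∧ momMatrix ρ = G ∧
    r = entropy ρ - ∫ x, U x * ρ x }

lemma Ffun_eq (n : ℕ) (U : (Fin n → ℝ) → ℝ) (G : Matrix (Fin n) (Fin n) ℝ) :
    Ffun n U G = sSup (ASet n U G) := rfl

lemma scale_int {n : ℕ} (s : ℝ) (hs : 0 < s) (f : (Fin n → ℝ) → ℝ) :
    ∫ x, (s⁻¹) ^ n * f (s⁻¹ • x) = ∫ x, f x := by
  rw [integral_const_mul, Measure.integral_comp_smul]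
  have h : 0 < (s⁻¹) ^ n := by positivity
  simp only [Module.finrank_fintype_fun_eq_card, Fintype.card_fin, smul_eq_mul]
  rw [abs_of_pos (by positivity), ← mul_assoc, mul_inv_cancel₀ h.ne', one_mul]

lemma scale_integrable {n : ℕ} (s : ℝ) (hs : 0 < s) (f : (Fin n → ℝ) → ℝ) (hf : Integrable f) :
    Integrable (fun x => (s⁻¹) ^ n * f (s⁻¹ • x)) := by
  apply Integrable.const_mul
  exact (integrable_comp_smul_iff volume f (inv_ne_zero hs.ne')).2 hf

lemma ASet_scale {n : ℕ} (U : (Fin n → ℝ) → ℝ) (hom : ∀ (s : ℝ) x, U (s • x) = s ^ 4 * U x)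
    (s : ℝ) (hs : 0 < s) (ε : ℝ) (G : Matrix (Fin n) (Fin n) ℝ) (r : ℝ)
    (hr : r ∈ ASet n (fun x => (s ^ 4 * ε) * U x) G) :
    r + n * Real.log s ∈ ASet n (fun x => ε * U x) (s ^ 2 • G) := by
  obtain ⟨ρ, ⟨hm, h0, h1, h2, hl⟩, hUi, hmom, rfl⟩ := hr
  have hs' := hs.ne'
  have hρ : Integrable ρ := by
    by_contra h
    rw [integral_undef h] at h1
    exact zero_ne_one h1
  have eU : (fun x : Fin n → ℝ => ε * U x * ((s⁻¹) ^ n * ρ (s⁻¹ • x))) =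
      fun x => (s⁻¹) ^ n * (fun y => (s ^ 4 * ε) * U y * ρ y) (s⁻¹ • x) := by
    funext x
    have : s ^ 4 * (s⁻¹) ^ 4 = 1 := by rw [← mul_pow, mul_inv_cancel₀ hs', one_pow]
    simp only [hom]
    linear_combination (-(s⁻¹) ^ n * ε * U x * ρ (s⁻¹ • x)) * this
  have eM : ∀ i j : Fin n, (fun x : Fin n → ℝ => x i * x j * ((s⁻¹) ^ n * ρ (s⁻¹ • x))) =
      fun x => (s⁻¹) ^ n * (fun y => s ^ 2 * (y i * y j * ρ y)) (s⁻¹ • x) := by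
    intro i j
    funext x
    have : s ^ 2 * (s⁻¹) ^ 2 = 1 := by rw [← mul_pow, mul_inv_cancel₀ hs', one_pow]
    simp only [Pi.smul_apply, smul_eq_mul]
    linear_combination (-(s⁻¹) ^ n * x i * x j * ρ (s⁻¹ • x)) * this
  have eS : (fun x : Fin n → ℝ => ((s⁻¹) ^ n * ρ (s⁻¹ • x)) * Real.log ((s⁻¹) ^ n * ρ (s⁻¹ • x))) =
      fun x => (s⁻¹) ^ n * (fun y => ρ y * Real.log (ρ y) - n * Real.log s * ρ y) (s⁻¹ • x) := by
    funext x
    by_cases hz : ρ (s⁻¹ • x) = 0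
    · simp [hz]
    · simp only
      rw [Real.log_mul (by positivity) hz, Real.log_pow, Real.log_inv]
      ring
  refine ⟨fun x => (s⁻¹) ^ n * ρ (s⁻¹ • x), ⟨?_, ?_, ?_, ?_, ?_⟩, ?_, ?_, ?_⟩
  · exact (hm.comp (measurable_const_smul _)).const_mul _
  · intro x; have := h0 (s⁻¹ • x); positivity
  · rw [scale_int s hs, h1]
  · intro i j
    rw [eM]
    exact scale_integrable s hs _ ((h2 i j).const_mul _)
  · rw [eS]
    exact scale_integrable s hs _ (hl.sub (hρ.const_mul _))
  · rw [eU]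
    exact scale_integrable s hs _ hUi
  · ext i j
    simp only [momMatrix, Matrix.of_apply, Matrix.smul_apply, smul_eq_mul, ← hmom]
    rw [eM, scale_int s hs (fun y => s ^ 2 * (y i * y j * ρ y)), integral_const_mul]
  · simp only [entropy]
    rw [eS, eU, scale_int s hs (fun y => ρ y * Real.log (ρ y) - n * Real.log s * ρ y),
      scale_int s hs (fun y => (s ^ 4 * ε) * U y * ρ y), integral_sub hl (hρ.const_mul _),
      integral_const_mul, h1]
    ring

lemma ASet_scale_eq {n : ℕ} (U : (Fin n → ℝ) → ℝ) (hom : ∀ (s : ℝ) x, U (s • x) = s ^ 4 * U x)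
    (s : ℝ) (hs : 0 < s) (ε : ℝ) (G : Matrix (Fin n) (Fin n) ℝ) :
    ASet n (fun x => ε * U x) (s ^ 2 • G) =
      (fun r => r + n * Real.log s) '' ASet n (fun x => (s ^ 4 * ε) * U x) G := by
  ext r
  constructor
  · intro hr
    have hs' := hs.ne'
    have h := ASet_scale U hom s⁻¹ (inv_pos.2 hs) (s ^ 4 * ε) (s ^ 2 • G) r (by
      have : (s⁻¹) ^ 4 * (s ^ 4 * ε) = ε := by field_simp
      rwa [this])
    have e : (s⁻¹) ^ 2 • s ^ 2 • G = G := by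
      rw [smul_smul, ← mul_pow, inv_mul_cancel₀ hs', one_pow, one_smul]
    rw [e] at h
    refine ⟨_, h, ?_⟩
    simp only [Real.log_inv]; ring
  · rintro ⟨q, hq, rfl⟩
    exact ASet_scale U hom s hs ε G q hq

def Good (A : Set ℝ) : Prop := A.Nonempty ∧ BddAbove A

lemma sSup_not_good {A : Set ℝ} (h : ¬ Good A) : sSup A = 0 := by
  rcases A.eq_empty_or_nonempty with rfl | hne
  · exact Real.sSup_empty
  · exact Real.sSup_of_not_bddAbove fun hb => h ⟨hne, hb⟩

lemma sSup_good {A : Set ℝ} (h : Good A) (b : ℝ) : sSup ((fun r => r + b) '' A) = sSup A + b := by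
  have := (OrderIso.addRight b).map_csSup' h.1 h.2
  simpa using this.symm

lemma not_good_image {A : Set ℝ} (h : ¬ Good A) (b : ℝ) : ¬ Good ((fun r => r + b) '' A) := by
  rintro ⟨h1, K, hK⟩
  refine h ⟨h1.of_image, K - b, fun r hr => ?_⟩
  have := hK ⟨r, hr, rfl⟩
  simp only at this
  linarith

lemma good_mono {n : ℕ} (U : (Fin n → ℝ) → ℝ) (hU0 : ∀ x, 0 ≤ U x)
    (G : Matrix (Fin n) (Fin n) ℝ) (ε ε' : ℝ) (h : 0 < ε) (hle : ε ≤ ε')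
    (hg : Good (ASet n (fun x => ε * U x) G)) : Good (ASet n (fun x => ε' * U x) G) := by
  have key : ∀ a b : ℝ, 0 < a → 0 < b → ∀ ρ : (Fin n → ℝ) → ℝ,
      Integrable (fun x => a * U x * ρ x) → Integrable (fun x => b * U x * ρ x) := by
    intro a b ha hb ρ hi
    have := hi.const_mul (b / a)
    refine this.congr (ae_of_all _ fun x => ?_)
    simp only
    field_simp
  obtain ⟨⟨r, ρ, h1, h2, h3, -⟩, K, hK⟩ := hg
  refine ⟨⟨_, ρ, h1, key ε ε' h (h.trans_le hle) ρ h2, h3, rfl⟩, K, ?_⟩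
  rintro r ⟨ρ, h1, h2, h3, rfl⟩
  have h2' := key ε' ε (h.trans_le hle) h ρ h2
  refine le_trans ?_ (hK ⟨ρ, h1, h2', h3, rfl⟩)
  have := integral_mono h2' h2 (fun x => by
    have a := h1.2.1 x
    have b := hU0 x
    simp only
    gcongr)
  linarith

lemma Phi_scale {n : ℕ} (U : (Fin n → ℝ) → ℝ) (hom : ∀ (s : ℝ) x, U (s • x) = s ^ 4 * U x)
    (G : Matrix (Fin n) (Fin n) ℝ) (hG : 0 < G.det) (t : ℝ) (ht : 0 < t) (ε : ℝ)
    (hg : Good (ASet n (fun x => (t ^ 2 * ε) * U x) G)) :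
    Phi n (fun x => ε * U x) (t • G) = Phi n (fun x => (t ^ 2 * ε) * U x) G := by
  have hs : 0 < √t := Real.sqrt_pos.2 ht
  have e2 : √t ^ 2 = t := Real.sq_sqrt ht.le
  have e4 : √t ^ 4 = t ^ 2 := by rw [show 4 = 2 * 2 from rfl, pow_mul, e2]
  have hA := ASet_scale_eq U hom (√t) hs ε G
  rw [e2, e4] at hA
  simp only [Phi, Ffun_eq]
  rw [hA, sSup_good hg, Matrix.det_smul, Real.log_mul (by positivity) hG.ne', Real.log_pow,
    Real.log_sqrt ht.le, Fintype.card_fin]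
  ring

lemma Phi_scale_bad {n : ℕ} (U : (Fin n → ℝ) → ℝ) (hom : ∀ (s : ℝ) x, U (s • x) = s ^ 4 * U x)
    (G : Matrix (Fin n) (Fin n) ℝ) (hG : 0 < G.det) (t : ℝ) (ht : 0 < t) (ε : ℝ)
    (hg : ¬ Good (ASet n (fun x => (t ^ 2 * ε) * U x) G)) :
    Phi n (fun x => ε * U x) (t • G) =
      - (n * Real.log t) - Real.log G.det - (n : ℝ) * Real.log (2 * π * Real.exp 1) := by
  have hs : 0 < √t := Real.sqrt_pos.2 ht
  have e2 : √t ^ 2 = t := Real.sq_sqrt ht.le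
  have e4 : √t ^ 4 = t ^ 2 := by rw [show 4 = 2 * 2 from rfl, pow_mul, e2]
  have hA := ASet_scale_eq U hom (√t) hs ε G
  rw [e2, e4] at hA
  simp only [Phi, Ffun_eq]
  rw [hA, sSup_not_good (not_good_image hg _), Matrix.det_smul,
    Real.log_mul (by positivity) hG.ne', Real.log_pow, Fintype.card_fin]
  ring

lemma U_nonneg {n : ℕ} (U : (Fin n → ℝ) → ℝ) (hom : ∀ (s : ℝ) x, U (s • x) = s ^ 4 * U x)
    (hU : SuperQuadratic U) (x : Fin n → ℝ) : 0 ≤ U x := by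
  by_cases hx : x = 0
  · have := hom 0 x
    simp only [zero_smul] at this
    rw [hx, this]; simp
  by_contra hneg
  push Not at hneg
  have h1 : Tendsto (fun s : ℝ => s • x) atTop (cocompact (Fin n → ℝ)) := by
    apply tendsto_cocompact_of_tendsto_dist_comp_atTop 0
    simp only [dist_zero_right, norm_smul]
    exact tendsto_norm_atTop_atTop.atTop_mul_const (norm_pos_iff.2 hx)
  have h2 := (hU.2 1 one_pos).comp h1
  obtain ⟨s, hs⟩ := (h2.eventually_gt_atTop 0).exists
  simp only [Function.comp, hom] at hs
  have : s ^ 4 * U x ≤ 0 := mul_nonpos_of_nonneg_of_nonpos (by positivity) hneg.le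
  have : 0 ≤ ‖s • x‖ ^ 2 := by positivity
  linarith

lemma asymp_unique (φ D : ℝ → ℝ) (c s : ℕ → ℝ)
    (hd : ∀ ε, 0 < ε → HasDerivAt φ (D ε / (2 * ε)) ε)
    (hφ : ∀ N : ℕ, (fun ε : ℝ => φ ε - ∑ k ∈ Finset.Icc 1 N, c k * ε ^ k)
        =O[𝓝[>] (0 : ℝ)] fun ε => ε ^ (N + 1))
    (hD : ∀ N : ℕ, (fun ε : ℝ => D ε - ∑ k ∈ Finset.Icc 1 N, s k * ε ^ k)
        =O[𝓝[>] (0 : ℝ)] fun ε => ε ^ (N + 1)) :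
    ∀ k : ℕ, 1 ≤ k → c k = 1 / (2 * (k : ℝ)) * s k := by
  have hφ0 : Tendsto φ (𝓝[>] 0) (𝓝 0) := by
    have h := (hφ 0).trans_tendsto (by
      have : Tendsto (fun ε : ℝ => ε ^ (0 + 1)) (𝓝 0) (𝓝 (0 ^ (0 + 1))) :=
        (continuous_pow _).tendsto 0
      simpa using this.mono_left nhdsWithin_le_nhds)
    simpa using h
  -- expansion obtained by integrating
  have hR : ∀ N : ℕ, (fun ε : ℝ => φ ε - ∑ k ∈ Finset.Icc 1 N, (1 / (2 * (k : ℝ)) * s k) * ε ^ k)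
        =O[𝓝[>] (0 : ℝ)] fun ε => ε ^ (N + 1) := by
    intro N
    obtain ⟨K, hK⟩ := (hD N).bound
    obtain ⟨δ, hδ, hb⟩ := mem_nhdsGT_iff_exists_Ioo_subset.1 hK
    simp only [Set.mem_Ioi] at hδ
    set R : ℝ → ℝ := fun ε => φ ε - ∑ k ∈ Finset.Icc 1 N, (1 / (2 * (k : ℝ)) * s k) * ε ^ k with hRdef
    have hRd : ∀ ε, 0 < ε → HasDerivAt R ((D ε - ∑ k ∈ Finset.Icc 1 N, s k * ε ^ k) / (2 * ε)) ε := by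
      intro ε hε
      have h1 : HasDerivAt (fun ε : ℝ => ∑ k ∈ Finset.Icc 1 N, (1 / (2 * (k : ℝ)) * s k) * ε ^ k)
          (∑ k ∈ Finset.Icc 1 N, (1 / (2 * (k : ℝ)) * s k) * (k * ε ^ (k - 1))) ε :=
        HasDerivAt.fun_sum fun k _ => (hasDerivAt_pow k ε).const_mul _
      have h2 := (hd ε hε).sub h1
      refine h2.congr_deriv ?_
      symm
      rw [sub_div, Finset.sum_div]
      congr 1
      refine Finset.sum_congr rfl fun k hk => ?_
      obtain ⟨m, rfl⟩ : ∃ m, k = m + 1 := ⟨k - 1, by have := (Finset.mem_Icc.1 hk).1; omega⟩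
      simp only [Nat.add_sub_cancel]
      have : ((m + 1 : ℕ) : ℝ) ≠ 0 := by positivity
      field_simp
      ring
    have hR0 : Tendsto R (𝓝[>] 0) (𝓝 0) := by
      have h1 : Tendsto (fun ε : ℝ => ∑ k ∈ Finset.Icc 1 N, (1 / (2 * (k : ℝ)) * s k) * ε ^ k)
          (𝓝[>] 0) (𝓝 (∑ k ∈ Finset.Icc 1 N, (1 / (2 * (k : ℝ)) * s k) * (0:ℝ) ^ k)) := by
        have hc : Continuous (fun ε : ℝ => ∑ k ∈ Finset.Icc 1 N, (1 / (2 * (k : ℝ)) * s k) * ε ^ k) := by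
          fun_prop
        exact (hc.tendsto 0).mono_left nhdsWithin_le_nhds
      have h2 : (∑ k ∈ Finset.Icc 1 N, (1 / (2 * (k : ℝ)) * s k) * (0:ℝ) ^ k) = 0 := by
        refine Finset.sum_eq_zero fun k hk => ?_
        have := (Finset.mem_Icc.1 hk).1
        rw [zero_pow (by omega), mul_zero]
      rw [h2] at h1
      have h3 := hφ0.sub h1
      rw [sub_zero] at h3
      exact h3
    refine IsBigO.of_bound |K| ?_
    filter_upwards [Ioo_mem_nhdsGT hδ] with ε hε
    have hbound : ∀ η ∈ Set.Ioo 0 ε, ‖R ε - R η‖ ≤ |K| * ε ^ N * (ε - η) := by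
      intro η hη
      have := (convex_Icc η ε).norm_image_sub_le_of_norm_hasDerivWithin_le (f := R)
        (C := |K| * ε ^ N)
        (fun x hx => (hRd x (hη.1.trans_le hx.1)).hasDerivWithinAt) (fun x hx => by
          have hx0 : 0 < x := hη.1.trans_le hx.1
          have h := hb ⟨hx0, hx.2.trans_lt hε.2⟩
          simp only [Set.mem_ofPred_eq] at h
          rw [norm_div, div_le_iff₀ (by rw [norm_pos_iff]; positivity)]
          refine h.trans ?_
          rw [norm_pow, Real.norm_of_nonneg hx0.le, Real.norm_of_nonneg (by positivity)]
          have a1 : x ^ N ≤ ε ^ N := pow_le_pow_left₀ hx0.le hx.2 N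
          calc K * x ^ (N + 1) ≤ |K| * x ^ (N + 1) := by gcongr; exact le_abs_self K
            _ = |K| * x ^ N * x := by ring
            _ ≤ |K| * ε ^ N * (2 * x) := by
              have hε0 : 0 < ε := hε.1
              exact mul_le_mul (mul_le_mul_of_nonneg_left a1 (abs_nonneg K)) (by linarith)
                hx0.le (by positivity))
        (Set.left_mem_Icc.2 hη.2.le) (Set.right_mem_Icc.2 hη.2.le)
      rwa [Real.norm_of_nonneg (sub_nonneg.2 hη.2.le)] at this
    have hl1 : Tendsto (fun η => ‖R ε - R η‖) (𝓝[>] 0) (𝓝 ‖R ε - 0‖) :=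
      (tendsto_const_nhds.sub hR0).norm
    have hfin : ‖R ε - 0‖ ≤ |K| * ε ^ N * ε := by
      refine le_of_tendsto hl1 ?_
      filter_upwards [Ioo_mem_nhdsGT hε.1] with η hη
      refine (hbound η hη).trans ?_
      have := hε.1.le
      have := hη.1
      gcongr
      linarith
    rw [sub_zero] at hfin
    rw [norm_pow, Real.norm_of_nonneg hε.1.le, pow_succ, ← mul_assoc]
    exact hfin
  intro k
  induction k using Nat.strong_induction_on with
  | _ k ih =>
    intro hk
    have h := (hR k).sub (hφ k)
    have h' : (fun ε : ℝ => (c k - 1 / (2 * (k : ℝ)) * s k) * ε ^ k)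
        =O[𝓝[>] (0 : ℝ)] fun ε => ε ^ (k + 1) := by
      refine h.congr_left fun ε => ?_
      obtain ⟨m, rfl⟩ : ∃ m, k = m + 1 := ⟨k - 1, by omega⟩
      rw [Finset.sum_Icc_succ_top (by omega), Finset.sum_Icc_succ_top (by omega)]
      have : ∑ j ∈ Finset.Icc 1 m, c j * ε ^ j =
          ∑ j ∈ Finset.Icc 1 m, (1 / (2 * (j : ℝ)) * s j) * ε ^ j := by
        refine Finset.sum_congr rfl fun j hj => ?_
        have := Finset.mem_Icc.1 hj
        rw [ih j (by omega) this.1]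
      rw [this]; ring
    obtain ⟨K, hK⟩ := h'.bound
    have hle : ∀ᶠ ε in 𝓝[>] (0:ℝ), |c k - 1 / (2 * (k : ℝ)) * s k| ≤ K * ε := by
      filter_upwards [hK, self_mem_nhdsWithin] with ε h1 h2
      have h2 : 0 < ε := h2
      rw [norm_mul, norm_pow, norm_pow, Real.norm_of_nonneg h2.le, Real.norm_eq_abs, pow_succ] at h1
      have hp : 0 < ε ^ k := by positivity
      refine le_of_mul_le_mul_right ?_ hp
      linarith
    have ht : Tendsto (fun ε : ℝ => K * ε) (𝓝[>] 0) (𝓝 0) := by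
      have : Tendsto (fun ε : ℝ => K * ε) (𝓝 0) (𝓝 (K * 0)) := (continuous_const_mul K).tendsto 0
      rw [mul_zero] at this
      exact this.mono_left nhdsWithin_le_nhds
    have := ge_of_tendsto ht hle
    have := abs_nonpos_iff.1 this
    linarith

/-- Relation between the Luttinger-Ward and self-energy expansion
coefficients: for the quartic interaction `U(x) = (1/8) Σ_{ij} v_{ij} x_i² x_j²` with
symmetric `v` and superquadratic growth, and `G ≻ 0`, the coefficients of the asymptotic
series of `Φ[G; εU]` and `Σ[G; εU]` at `ε = 0` satisfy
`Φ^(k) = (1/(2k)) Tr[G Σ^(k)]` for every `k ≥ 1`. -/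
theorem statement14 (n : ℕ) (hn : 1 ≤ n)
    (v : Matrix (Fin n) (Fin n) ℝ) (hv : v.IsSymm)
    (U : (Fin n → ℝ) → ℝ)
    (hUdef : U = fun x => (1 / 8) * ∑ i, ∑ j, v i j * (x i) ^ 2 * (x j) ^ 2)
    (hU : SuperQuadratic U)
    (G : Matrix (Fin n) (Fin n) ℝ) (hG : G.PosDef)
    (Sig : ℝ → Matrix (Fin n) (Fin n) ℝ)
    (hSig : ∀ ε : ℝ, 0 < ε → (Sig ε).IsSymm ∧
      HasFDerivWithinAt (Phi n (fun x => ε * U x)) (tracePairing (Sig ε))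
        {M : Matrix (Fin n) (Fin n) ℝ | M.IsSymm} G)
    (c : ℕ → ℝ) (S : ℕ → Matrix (Fin n) (Fin n) ℝ)
    (hSsymm : ∀ k, (S k).IsSymm)
    (hPhiAsymp : ∀ N : ℕ,
      (fun ε : ℝ => Phi n (fun x => ε * U x) G - ∑ k ∈ Finset.Icc 1 N, c k * ε ^ k)
        =O[𝓝[>] (0 : ℝ)] fun ε => ε ^ (N + 1))
    (hSigAsymp : ∀ N : ℕ,
      (fun ε : ℝ => Sig ε - ∑ k ∈ Finset.Icc 1 N, ε ^ k • S k)
        =O[𝓝[>] (0 : ℝ)] fun ε => ε ^ (N + 1)) :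
    ∀ k : ℕ, 1 ≤ k → c k = (1 / (2 * (k : ℝ))) * (G * S k).trace := by
  have hom : ∀ (s : ℝ) x, U (s • x) = s ^ 4 * U x := by
    intro s x
    subst hUdef
    simp only [Pi.smul_apply, smul_eq_mul, Finset.mul_sum]
    refine Finset.sum_congr rfl fun i _ => Finset.sum_congr rfl fun j _ => ?_
    ring
  have hU0 := U_nonneg U hom hU
  have hdet := hG.det_pos
  have hGs : G.IsSymm := by
    have := hG.isHermitian
    rwa [Matrix.IsHermitian, Matrix.conjTranspose_eq_transpose_of_trivial] at this
  set D : ℝ → ℝ := fun ε => tracePairing G (Sig ε) with hDdef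
  have hDeq : ∀ M : Matrix (Fin n) (Fin n) ℝ, tracePairing G M = (G * M).trace := fun M => rfl
  have hDeq' : ∀ M : Matrix (Fin n) (Fin n) ℝ, tracePairing M G = tracePairing G M := fun M =>
    (show (M * G).trace = (G * M).trace from Matrix.trace_mul_comm _ _)
  have hDas : ∀ N : ℕ, (fun ε : ℝ => D ε - ∑ k ∈ Finset.Icc 1 N, (G * S k).trace * ε ^ k)
        =O[𝓝[>] (0 : ℝ)] fun ε => ε ^ (N + 1) := by
    intro N
    have h := ((tracePairing G).isBigO_comp (fun ε : ℝ => Sig ε - ∑ k ∈ Finset.Icc 1 N, ε ^ k • S k)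
      (𝓝[>] (0:ℝ))).trans (hSigAsymp N)
    refine h.congr_left fun ε => ?_
    change (G * (Sig ε - ∑ k ∈ Finset.Icc 1 N, ε ^ k • S k)).trace =
      (G * Sig ε).trace - ∑ k ∈ Finset.Icc 1 N, (G * S k).trace * ε ^ k
    rw [Matrix.mul_sub, Matrix.trace_sub, Matrix.mul_sum, Matrix.trace_sum]
    congr 1
    refine Finset.sum_congr rfl fun k _ => ?_
    rw [Matrix.mul_smul, Matrix.trace_smul, smul_eq_mul, mul_comm]
  have hD0 : Tendsto D (𝓝[>] 0) (𝓝 0) := by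
    have h := (hDas 0).trans_tendsto (by
      have : Tendsto (fun ε : ℝ => ε ^ (0 + 1)) (𝓝 0) (𝓝 (0 ^ (0 + 1))) :=
        (continuous_pow _).tendsto 0
      simpa using this.mono_left nhdsWithin_le_nhds)
    simpa using h
  -- derivative along a path of multiples of G
  have hpath : ∀ ε : ℝ, 0 < ε → ∀ (τ : ℝ → ℝ) (τ' x : ℝ), HasDerivAt τ τ' x → τ x = 1 →
      HasDerivAt (fun y => Phi n (fun x => ε * U x) (τ y • G)) (τ' * D ε) x := by
    intro ε hε τ τ' x hτ hx
    have h1 : HasDerivAt (fun y => τ y • G) (τ' • G) x := hτ.smul_const G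
    have h2 := (hSig ε hε).2
    have h3 : HasFDerivWithinAt (Phi n (fun x => ε * U x)) (tracePairing (Sig ε))
        {M : Matrix (Fin n) (Fin n) ℝ | M.IsSymm} (τ x • G) := by
      rw [hx, one_smul]; exact h2
    have h4 := h3.comp_hasDerivAt x h1 (Eventually.of_forall fun y => hGs.smul _)
    refine h4.congr_deriv ?_
    change (Sig ε * (τ' • G)).trace = τ' * (G * Sig ε).trace
    rw [Matrix.mul_smul, Matrix.trace_smul, smul_eq_mul, Matrix.trace_mul_comm]
  have hgood : ∀ ε : ℝ, 0 < ε → Good (ASet n (fun x => ε * U x) G) := by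
    intro ε₀ hε₀
    by_contra hbad
    have hbad' : ∀ ε, 0 < ε → ε ≤ ε₀ → ¬ Good (ASet n (fun x => ε * U x) G) :=
      fun ε h1 h2 h => hbad (good_mono U hU0 G ε ε₀ h1 h2 h)
    have hDn : ∀ ε ∈ Set.Ioo 0 ε₀, D ε = -n := by
      intro ε hε
      have h1 := hpath ε hε.1 (fun t => t) 1 1 (hasDerivAt_id 1) rfl
      have h2 : HasDerivAt (fun t => - (n * Real.log t) - Real.log G.det -
          (n : ℝ) * Real.log (2 * π * Real.exp 1)) (-(n * (1:ℝ)⁻¹)) 1 :=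
        ((((Real.hasDerivAt_log one_ne_zero).const_mul (n:ℝ)).neg).sub_const _).sub_const _
      have h3 : (fun t : ℝ => Phi n (fun x => ε * U x) (t • G)) =ᶠ[𝓝 1]
          (fun t => - (n * Real.log t) - Real.log G.det -
          (n : ℝ) * Real.log (2 * π * Real.exp 1)) := by
        have hc : Tendsto (fun t : ℝ => t ^ 2 * ε) (𝓝 1) (𝓝 (1 ^ 2 * ε)) :=
          (by fun_prop : Continuous (fun t : ℝ => t ^ 2 * ε)).tendsto 1
        filter_upwards [lt_mem_nhds (one_pos : (0:ℝ) < 1),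
          hc.eventually (gt_mem_nhds (show 1 ^ 2 * ε < ε₀ by simpa using hε.2))] with t ht ht2
        exact Phi_scale_bad U hom G hdet t ht ε
          (hbad' _ (mul_pos (pow_pos ht 2) hε.1) ht2.le)
      have := h1.unique (h2.congr_of_eventuallyEq h3)
      simpa using this
    have h1 : Tendsto D (𝓝[>] 0) (𝓝 (-n : ℝ)) := by
      refine tendsto_const_nhds.congr' ?_
      filter_upwards [Ioo_mem_nhdsGT hε₀] with ε hε
      exact (hDn ε hε).symm
    have := tendsto_nhds_unique h1 hD0
    have hn' : (1:ℝ) ≤ n := by exact_mod_cast hn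
    linarith
  have hder : ∀ ε, 0 < ε →
      HasDerivAt (fun ε => Phi n (fun x => ε * U x) G) (D ε / (2 * ε)) ε := by
    intro ε hε
    have hτ : HasDerivAt (fun η : ℝ => √(η / ε)) (1 / ε / (2 * √(ε / ε))) ε :=
      ((hasDerivAt_id ε).div_const ε).sqrt (by simp [hε.ne'])
    have h1 := hpath ε hε _ _ ε hτ (by simp [hε.ne'])
    have h2 : (fun η => Phi n (fun x => η * U x) G) =ᶠ[𝓝 ε]
        fun η => Phi n (fun x => ε * U x) (√(η / ε) • G) := by
      filter_upwards [lt_mem_nhds hε] with η hη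
      have e : √(η / ε) ^ 2 * ε = η := by
        rw [Real.sq_sqrt (by positivity)]; field_simp
      have := Phi_scale U hom G hdet (√(η / ε)) (by positivity) ε (by rw [e]; exact hgood η hη)
      rw [this, e]
    refine (h1.congr_of_eventuallyEq h2).congr_deriv ?_
    rw [div_self hε.ne', Real.sqrt_one]
    field_simp
  exact asymp_unique _ D c _ hder hPhiAsymp hDas
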